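/- If G is a finite outerplanar graph with Δ(G) ≥ 4, then χ_{vi,2}(G) ≤ Δ(G) + 3. -/

import Mathlib

open SimpleGraph

variable {V : Type*}

/-- `(v, e)` is an incidence of `G`: `e` is an edge of `G` and `v ∈ e`. -/
def SimpleGraph.IsIncidence (G : SimpleGraph V) (v : V) (e : Sym2 V) : Prop :=
  e ∈ G.edgeSet ∧ v ∈ e

/-- A vi-simultaneous proper `k`-coloring of `G`, given by a coloring `cV` of the vertices
and a coloring `cI` of the incidences (the value of `cI v e` matters only when `(v, e)` is
an incidence of `G`). -/
structure SimpleGraph.IsViColoring (G : SimpleGraph V) (k : ℕ)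
    (cV : V → Fin k) (cI : V → Sym2 V → Fin k) : Prop where
  /-- adjacent vertices receive distinct colors -/
  adj_ne : ∀ ⦃u v⦄, G.Adj u v → cV u ≠ cV v
  /-- a vertex `u` and an incidence `(w, f)` with `u ∈ f` receive distinct colors -/
  vertex_inc_ne : ∀ ⦃u w f⦄, G.IsIncidence w f → u ∈ f → cV u ≠ cI w f
  /-- two distinct incidences `(v, e)` and `(w, f)` receive distinct colors whenever
  `v = w`, or `e = f`, or the edge `{v, w}` equals `e` or `f` -/
  inc_ne : ∀ ⦃v e w f⦄, G.IsIncidence v e → G.IsIncidence w f → (v, e) ≠ (w, f) →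
    (v = w ∨ e = f ∨ s(v, w) = e ∨ s(v, w) = f) → cI v e ≠ cI w f

/-- The set of colors appearing on the second incidences
`I_2(u) = {(v, {u, v}) : v adjacent to u}` of a vertex `u`. -/
def SimpleGraph.secondIncColors (G : SimpleGraph V) {k : ℕ}
    (cI : V → Sym2 V → Fin k) (u : V) : Set (Fin k) :=
  {a | ∃ v, G.Adj u v ∧ cI v s(u, v) = a}

/-- The vi-simultaneous chromatic number `χ_vi(G)`. -/
noncomputable def SimpleGraph.chiVi (G : SimpleGraph V) : ℕ :=
  sInf {k | ∃ cV cI, G.IsViColoring k cV cI}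

/-- `χ_{vi,s}(G)`: the least `k` admitting a vi-simultaneous `(k, s)`-coloring, i.e. a
vi-simultaneous proper `k`-coloring using at most `s` colors on `I_2(v)` for each vertex `v`. -/
noncomputable def SimpleGraph.chiViS (G : SimpleGraph V) (s : ℕ) : ℕ :=
  sInf {k | ∃ cV cI, G.IsViColoring k cV cI ∧
    ∀ u, (G.secondIncColors cI u).ncard ≤ s}

/-- `G` is outerplanar: there is a linear ordering of the vertices such that no two edges
`{a, b}` and `{c, d}` satisfy `a < c < b < d`. -/
def SimpleGraph.Outerplanar (G : SimpleGraph V) : Prop :=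
  ∃ r : LinearOrder V, ∀ a b c d : V, G.Adj a b → G.Adj c d →
    ¬(r.lt a c ∧ r.lt c b ∧ r.lt b d)

/-- The maximum degree `Δ(G)` of a finite graph. -/
noncomputable def SimpleGraph.maxDeg (G : SimpleGraph V) [Fintype V] : ℕ :=
  Finset.univ.sup fun v => (G.neighborSet v).ncard

/-- `G` is 2-connected: it has at least 3 vertices, is connected, and deleting any single
vertex leaves it connected. -/
def SimpleGraph.TwoConnected (G : SimpleGraph V) [Fintype V] : Prop :=
  3 ≤ Fintype.card V ∧ G.Connected ∧
    ∀ v : V, (((⊤ : G.Subgraph).deleteVerts {v}).coe).Connected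

/-- A coloring of the subgraph of `G` induced on `A`: `p` colors the vertices, `o u v` is the
color of the incidence `(u, {u, v})`, and `S v` is a palette of two colors containing all colors
of the second incidences of `v`. -/
structure SimpleGraph.IsPaletteColoring {K : Type*} (G : SimpleGraph V) (A : Finset V)
    (p : V → K) (S : V → Finset K) (o : V → V → K) : Prop where
  card_palette : ∀ v ∈ A, (S v).card = 2
  vertex_notMem : ∀ v ∈ A, p v ∉ S v
  vertex_ne : ∀ u ∈ A, ∀ v ∈ A, G.Adj u v → p u ≠ p v
  out_mem : ∀ u ∈ A, ∀ v ∈ A, G.Adj u v → o u v ∈ S v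
  out_notMem : ∀ u ∈ A, ∀ v ∈ A, G.Adj u v → o u v ∉ S u
  out_ne_vertex : ∀ u ∈ A, ∀ v ∈ A, G.Adj u v → o u v ≠ p u
  out_inj : ∀ u ∈ A, ∀ v ∈ A, ∀ w ∈ A, G.Adj u v → G.Adj u w → v ≠ w → o u v ≠ o u w

namespace SimpleGraph.IsPaletteColoring

variable {K : Type*} {G : SimpleGraph V} {A : Finset V} {p : V → K} {S : V → Finset K}
  {o : V → V → K}

/-- Extend a palette coloring to one new vertex `v`, with color `c`, palette `T`, incidences
`(x, {x, v})` colored by `i` and incidences `(v, {v, x})` colored by `out`. -/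
theorem extend [DecidableEq V] (h : G.IsPaletteColoring A p S o) (v : V)
    (c : K) (T : Finset K) (i out : V → K) (hT : T.card = 2) (hc : c ∉ T)
    (hin : ∀ x ∈ A, G.Adj v x → i x ∈ T ∧ i x ∉ S x ∧ i x ≠ p x ∧
      ∀ y ∈ A, G.Adj x y → i x ≠ o x y)
    (hout : ∀ x ∈ A, G.Adj v x → out x ∈ S x ∧ out x ∉ T ∧ out x ≠ c ∧ c ≠ p x)
    (hinj : ∀ x ∈ A, ∀ y ∈ A, G.Adj v x → G.Adj v y → x ≠ y → out x ≠ out y) :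
    G.IsPaletteColoring (insert v A) (fun x => if x = v then c else p x)
      (fun x => if x = v then T else S x)
      (fun x y => if x = v then out y else if y = v then i x else o x y) := by
  obtain ⟨h1, h2, h3, h4, h5, h6, h7⟩ := h
  have hs : ∀ x y, G.Adj x y → G.Adj y x := fun _ _ h => h.symm
  have hl : ∀ x, ¬ G.Adj x x := fun _ h => h.ne rfl
  constructor <;> grind

/-- A vertex of `A` with at most `D - 1` neighbors in `A` has a free color among `D + 3`. -/
theorem exists_free [Fintype K] (h : G.IsPaletteColoring A p S o) {D : ℕ}
    (hK : Fintype.card K = D + 3) {u : V} (hu : u ∈ A)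
    (hd : {x ∈ (A : Set V) | G.Adj u x}.ncard < D) :
    ∃ α, α ∉ S u ∧ α ≠ p u ∧ ∀ y ∈ A, G.Adj u y → α ≠ o u y := by
  classical
  let N := A.filter (G.Adj u)
  have hN : N.card < D := by
    rw [← Set.ncard_coe_finset]
    simpa [N] using hd
  have hcard : (insert (p u) (S u ∪ N.image (o u))).card < Fintype.card K := by
    have h1 := Finset.card_insert_le (p u) (S u ∪ N.image (o u))
    have h2 := Finset.card_union_le (S u) (N.image (o u))
    have h3 : (N.image (o u)).card ≤ N.card := Finset.card_image_le
    have h4 := h.card_palette u hu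
    omega
  obtain ⟨α, hα⟩ := Finset.exists_mem_notMem_of_card_lt_card (s := _) (t := Finset.univ)
    (by simpa using hcard)
  refine ⟨α, ?_⟩
  simp only [Finset.mem_univ, Finset.mem_insert, Finset.mem_union, Finset.mem_image, N,
    Finset.mem_filter, true_and] at hα
  grind

end SimpleGraph.IsPaletteColoring

/-- Among at least seven colors, one avoids any six given ones. -/
theorem exists_ne_of_seven_le_card {K : Type*} [Fintype K] (hK : 7 ≤ Fintype.card K)
    (a b c d e f : K) : ∃ x, x ≠ a ∧ x ≠ b ∧ x ≠ c ∧ x ≠ d ∧ x ≠ e ∧ x ≠ f := by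
  classical
  have h6 : ({a, b, c, d, e, f} : Finset K).card ≤ 6 := Finset.card_le_six
  obtain ⟨x, hx⟩ := Finset.exists_mem_notMem_of_card_lt_card
    (s := ({a, b, c, d, e, f} : Finset K)) (t := Finset.univ)
    (by simp only [Finset.card_univ]; omega)
  exact ⟨x, by simpa using hx⟩

namespace SimpleGraph

variable {G : SimpleGraph V}

/-- A nonempty finite vertex set of a graph drawn without crossings along a line contains a
vertex of degree at most one, or a vertex of degree two whose neighbors are adjacent, or two
adjacent vertices of degree two with no common neighbor; degrees are taken inside the set. -/
theorem exists_reducible_of_noncrossing [LinearOrder V]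
    (hG : ∀ a b c d : V, G.Adj a b → G.Adj c d → ¬(a < c ∧ c < b ∧ b < d))
    (A : Finset V) (hA : A.Nonempty) :
    (∃ v ∈ A, ∃ u, ∀ x ∈ A, G.Adj v x → x = u) ∨
    (∃ v ∈ A, ∃ u ∈ A, ∃ w ∈ A, u ≠ w ∧ G.Adj v u ∧ G.Adj v w ∧ G.Adj u w ∧
      ∀ x ∈ A, G.Adj v x → x = u ∨ x = w) ∨
    (∃ v₁ ∈ A, ∃ v₂ ∈ A, ∃ u ∈ A, ∃ w ∈ A, u ≠ w ∧ G.Adj v₁ v₂ ∧ G.Adj v₁ u ∧ G.Adj v₂ w ∧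
      u ≠ v₂ ∧ w ≠ v₁ ∧
      (∀ x ∈ A, G.Adj v₁ x → x = u ∨ x = v₂) ∧ (∀ x ∈ A, G.Adj v₂ x → x = v₁ ∨ x = w)) := by
  classical
  by_cases hleaf : ∃ v ∈ A, ∃ u, ∀ x ∈ A, G.Adj v x → x = u
  · exact Or.inl hleaf
  right
  have htwo : ∀ v ∈ A, ∃ x ∈ A, ∃ y ∈ A, x < y ∧ G.Adj v x ∧ G.Adj v y := by
    intro v hv
    by_contra! hcon
    by_cases hx : ∃ x ∈ A, G.Adj v x
    · obtain ⟨x, hx, hvx⟩ := hx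
      refine hleaf ⟨v, hv, x, fun y hy hvy => ?_⟩
      rcases lt_trichotomy x y with h | h | h
      · exact absurd hvy (hcon x hx y hy h hvx)
      · exact h.symm
      · exact absurd hvx (hcon y hy x hx h hvy)
    · exact hleaf ⟨v, hv, v, fun y hy hvy => absurd ⟨y, hy, hvy⟩ hx⟩
  let I : V × V → Finset V := fun q => A.filter fun x => q.1 < x ∧ x < q.2
  let E : Finset (V × V) := {q ∈ A ×ˢ A | q.1 < q.2 ∧ G.Adj q.1 q.2 ∧ (I q).Nonempty}
  have hE : E.Nonempty := by
    have hm := A.min'_mem hA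
    obtain ⟨x, hx, y, hy, hxy, h1, h2⟩ := htwo _ hm
    have hmx : A.min' hA < x := lt_of_le_of_ne (A.min'_le x hx) h1.ne
    exact ⟨(A.min' hA, y), by
      simp only [E, I, Finset.mem_filter, Finset.mem_product]
      exact ⟨⟨hm, hy⟩, hmx.trans hxy, h2, x, by simp [hx, hmx, hxy]⟩⟩
  obtain ⟨⟨a, b⟩, hab, hmin⟩ := E.exists_min_image (fun q => (I q).card) hE
  simp only [E, Finset.mem_filter, Finset.mem_product] at hab
  obtain ⟨⟨ha, hb⟩, hlt, hadj, x, hx⟩ := hab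
  have hshort : ∀ c ∈ A, ∀ d ∈ A, c < d → G.Adj c d → a ≤ c → d ≤ b → (a < c ∨ d < b) →
      ∀ z ∈ A, ¬(c < z ∧ z < d) := by
    intro c hc d hd hcd hadj' hac hdb hor z hz hczd
    have hmem : (c, d) ∈ E := by
      simp only [E, I, Finset.mem_filter, Finset.mem_product]
      exact ⟨⟨hc, hd⟩, hcd, hadj', z, by simp [hz, hczd]⟩
    refine absurd (hmin _ hmem) (not_le.mpr (Finset.card_lt_card ?_))
    rw [Finset.ssubset_iff_of_subset]
    · rcases hor with h | h
      · exact ⟨c, by simp [I, hc, h, hcd.trans_le hdb], by simp [I]⟩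
      · exact ⟨d, by simp [I, hd, h, hac.trans_lt hcd], by simp [I]⟩
    · intro y
      simp only [I, Finset.mem_filter]
      exact fun hy => ⟨hy.1, hac.trans_lt hy.2.1, hy.2.2.trans_le hdb⟩
  have hnbr : ∀ x ∈ A, a < x → x < b → ∃ l ∈ A, ∃ r ∈ A, a ≤ l ∧ l < x ∧ x < r ∧ r ≤ b ∧
      G.Adj x l ∧ G.Adj x r ∧ ∀ y ∈ A, G.Adj x y → y = l ∨ y = r := by
    intro x hx hax hxb
    have hle : ∀ y, G.Adj x y → a ≤ y ∧ y ≤ b := fun y hy =>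
      ⟨not_lt.mp fun h => hG y x a b hy.symm hadj ⟨h, hax, hxb⟩,
        not_lt.mp fun h => hG a b x y hadj hy ⟨hax, hxb, h⟩⟩
    have hright : ∀ y ∈ A, ∀ z ∈ A, G.Adj x y → G.Adj x z → x < y → ¬ y < z :=
      fun y hy z hz h1 h2 h3 h4 =>
        hshort x hx z hz (h3.trans h4) h2 hax.le (hle z h2).2 (Or.inl hax) y hy ⟨h3, h4⟩
    have hleft : ∀ y ∈ A, ∀ z ∈ A, G.Adj x y → G.Adj x z → z < x → ¬ y < z :=
      fun y hy z hz h1 h2 h3 h4 =>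
        hshort y hy x hx (h4.trans h3) h1.symm (hle y h1).1 hxb.le (Or.inr hxb) z hz ⟨h4, h3⟩
    obtain ⟨l, hl, r, hr, hlr, hxl, hxr⟩ := htwo x hx
    have hlx : l < x := lt_of_le_of_ne (not_lt.mp fun h => hright l hl r hr hxl hxr h hlr) hxl.ne'
    have hxr' : x < r := lt_of_le_of_ne (not_lt.mp fun h => hleft l hl r hr hxl hxr h hlr) hxr.ne
    refine ⟨l, hl, r, hr, (hle l hxl).1, hlx, hxr', (hle r hxr).2, hxl, hxr, fun y hy hxy => ?_⟩
    rcases lt_or_gt_of_ne hxy.ne with h | h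
    · exact Or.inr (le_antisymm (not_lt.mp (hright r hr y hy hxr hxy hxr'))
        (not_lt.mp (hright y hy r hr hxy hxr h)))
    · exact Or.inl (le_antisymm (not_lt.mp (hleft l hl y hy hxl hxy h))
        (not_lt.mp (hleft y hy l hl hxy hxl hlx)))
  simp only [I, Finset.mem_filter] at hx
  obtain ⟨hxA, hax, hxb⟩ := hx
  obtain ⟨l, hl, r, hr, hal, hlx, hxr, hrb, hxl, hxr', hN⟩ := hnbr x hxA hax hxb
  rcases hal.eq_or_lt with rfl | hal
  · rcases hrb.eq_or_lt with rfl | hrb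
    · exact Or.inl ⟨x, hxA, a, ha, r, hr, hlt.ne, hxl, hxr', hadj, hN⟩
    · obtain ⟨l', hl', r', hr', -, hlr, hrr, -, h1, h2, hN'⟩ := hnbr r hr (hax.trans hxr) hrb
      obtain rfl : x = l' := (hN' x hxA hxr'.symm).resolve_right (hxr.trans hrr).ne
      exact Or.inr ⟨x, hxA, r, hr, a, ha, r', hr', (hax.trans (hxr.trans hrr)).ne, hxr', hxl, h2,
        (hax.trans hxr).ne, (hxr.trans hrr).ne', hN, hN'⟩
  · obtain ⟨l', hl', r', hr', -, hll, hlr, -, h1, h2, hN'⟩ := hnbr l hl hal (hlx.trans hxb)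
    obtain rfl : x = r' := (hN' x hxA hxl.symm).resolve_left (hll.trans hlx).ne'
    exact Or.inr ⟨l, hl, x, hxA, l', hl', r, hr, (hll.trans (hlx.trans hxr)).ne, hxl.symm, h1,
      hxr', (hll.trans hlx).ne, (hlx.trans hxr).ne', hN', hN⟩

/-- An outerplanar graph of maximum degree at most `D`, where `D ≥ 4`, has a palette coloring with
`D + 3` colors on every finite vertex set. -/
theorem exists_isPaletteColoring_of_noncrossing {K : Type*} [Fintype K] [Finite V] [LinearOrder V]
    (hG : ∀ a b c d : V, G.Adj a b → G.Adj c d → ¬(a < c ∧ c < b ∧ b < d)) {D : ℕ} (hD : 4 ≤ D)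
    (hK : Fintype.card K = D + 3) (hdeg : ∀ v, (G.neighborSet v).ncard ≤ D) (A : Finset V) :
    ∃ (p : V → K) (S : V → Finset K) (o : V → V → K), G.IsPaletteColoring A p S o := by
  classical
  have hfresh := exists_ne_of_seven_le_card (K := K) (by omega)
  have hlt : ∀ (B : Finset V) (u v : V), G.Adj u v → v ∉ B →
      {x ∈ (B : Set V) | G.Adj u x}.ncard < D := by
    intro B u v huv hv
    refine lt_of_lt_of_le (Set.ncard_lt_ncard ?_ (Set.toFinite _)) (hdeg u)
    refine ⟨fun x hx => hx.2, fun h => hv (h huv).1⟩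
  induction A using Finset.strongInduction with
  | H A ih =>
  obtain rfl | hA := A.eq_empty_or_nonempty
  · have : Nonempty K := Fintype.card_pos_iff.mp (by omega)
    exact ⟨fun _ => Classical.arbitrary K, fun _ => ∅, fun _ _ => Classical.arbitrary K,
      by constructor <;> simp⟩
  rcases exists_reducible_of_noncrossing hG A hA with ⟨v, hv, u, hN⟩ |
    ⟨v, hv, u, hu, w, hw, huw, hvu, hvw, huw', hN⟩ |
    ⟨v₁, hv₁, v₂, hv₂, u, hu, w, hw, huw, h12, h1u, h2w, hu2, hw1, hN₁, hN₂⟩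
  · obtain ⟨p, S, o, h⟩ := ih _ (Finset.erase_ssubset hv)
    have hv' : v ∉ A.erase v := Finset.notMem_erase v A
    rw [← Finset.insert_erase hv]
    by_cases hu : u ∈ A.erase v ∧ G.Adj v u
    · obtain ⟨hu, hvu⟩ := hu
      obtain ⟨α, hα⟩ := h.exists_free hK hu (hlt _ u v hvu.symm hv')
      obtain ⟨a, ha⟩ := Finset.card_pos.mp (by rw [h.card_palette u hu]; norm_num : 0 < (S u).card)
      obtain ⟨s, hs⟩ := hfresh α a α α α α
      obtain ⟨c, hc⟩ := hfresh α a s (p u) α α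
      refine ⟨_, _, _, h.extend v c {α, s} (fun _ => α) (fun _ => a)
        (Finset.card_pair hs.1.symm) ?_ ?_ ?_ ?_⟩ <;> grind
    · obtain ⟨c⟩ : Nonempty K := Fintype.card_pos_iff.mp (by omega)
      obtain ⟨s, hs⟩ := hfresh c c c c c c
      obtain ⟨t, ht⟩ := hfresh c s c c c c
      refine ⟨_, _, _, h.extend v c {s, t} (fun _ => c) (fun _ => c)
        (Finset.card_pair ht.2.1.symm) ?_ ?_ ?_ ?_⟩ <;> grind
  · obtain ⟨p, S, o, h⟩ := ih _ (Finset.erase_ssubset hv)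
    have hv' : v ∉ A.erase v := Finset.notMem_erase v A
    rw [← Finset.insert_erase hv]
    replace hu : u ∈ A.erase v := Finset.mem_erase.mpr ⟨hvu.ne', hu⟩
    replace hw : w ∈ A.erase v := Finset.mem_erase.mpr ⟨hvw.ne', hw⟩
    obtain ⟨α, hα⟩ := h.exists_free hK hu (hlt _ u v hvu.symm hv')
    obtain ⟨β, hβ⟩ := h.exists_free hK hw (hlt _ w v hvw.symm hv')
    have ha := h.out_mem w hw u hu huw'.symm
    have ha' := h.out_notMem w hw u hu huw'.symm
    have hb := h.out_mem u hu w hw huw'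
    have hb' := h.out_notMem u hu w hw huw'
    have haβ := hβ.2.2 u hu huw'.symm
    have hbα := hα.2.2 w hw huw'
    obtain ⟨T, hT, hαT, hβT, haT, hbT⟩ : ∃ T : Finset K, T.card = 2 ∧ α ∈ T ∧ β ∈ T ∧
        o w u ∉ T ∧ o u w ∉ T := by
      by_cases hαβ : α = β
      · obtain ⟨s, hs⟩ := hfresh α (o w u) (o u w) α α α
        exact ⟨{α, s}, Finset.card_pair hs.1.symm, by grind, by grind, by grind, by grind⟩
      · exact ⟨{α, β}, Finset.card_pair hαβ, by grind, by grind, by grind, by grind⟩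
    obtain ⟨c, hcT, hc⟩ : ∃ c, c ∉ T ∧ c ≠ o w u ∧ c ≠ o u w ∧ c ≠ p u ∧ c ≠ p w := by
      obtain ⟨s, t, -, rfl⟩ := Finset.card_eq_two.mp hT
      obtain ⟨c, hc⟩ := hfresh s t (o w u) (o u w) (p u) (p w)
      exact ⟨c, by grind, by grind⟩
    refine ⟨_, _, _, h.extend v c T (fun x => if x = u then α else β)
      (fun x => if x = u then o w u else o u w) hT hcT ?_ ?_ ?_⟩ <;> grind
  · have hv₂' : v₂ ∉ (A.erase v₁).erase v₂ := Finset.notMem_erase _ _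
    have hv₁' : v₁ ∉ (A.erase v₁).erase v₂ := by simp
    have hv₂e : v₂ ∈ A.erase v₁ := Finset.mem_erase.mpr ⟨h12.ne', hv₂⟩
    obtain ⟨p, S, o, h⟩ := ih ((A.erase v₁).erase v₂)
      ((Finset.erase_subset _ _).trans_ssubset (Finset.erase_ssubset hv₁))
    have hA' : A = insert v₁ (insert v₂ ((A.erase v₁).erase v₂)) := by
      rw [Finset.insert_erase hv₂e, Finset.insert_erase hv₁]
    replace hu : u ∈ (A.erase v₁).erase v₂ := by
      simp only [Finset.mem_erase]
      exact ⟨hu2, h1u.ne', hu⟩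
    replace hw : w ∈ (A.erase v₁).erase v₂ := by
      simp only [Finset.mem_erase]
      exact ⟨h2w.ne', hw1, hw⟩
    replace hN₁ : ∀ x ∈ (A.erase v₁).erase v₂, G.Adj v₁ x → x = u := by grind
    replace hN₂ : ∀ x ∈ (A.erase v₁).erase v₂, G.Adj v₂ x → x = w := by grind
    generalize (A.erase v₁).erase v₂ = B at *
    subst hA'
    obtain ⟨α, hα⟩ := h.exists_free hK hu (hlt _ u v₁ h1u.symm hv₁')
    obtain ⟨β, hβ⟩ := h.exists_free hK hw (hlt _ w v₂ h2w.symm hv₂')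
    obtain ⟨a, ha⟩ := Finset.card_pos.mp (by rw [h.card_palette u hu]; norm_num : 0 < (S u).card)
    obtain ⟨b, hb⟩ := Finset.card_pos.mp (by rw [h.card_palette w hw]; norm_num : 0 < (S w).card)
    obtain ⟨t, ht⟩ := hfresh α β a b α α
    obtain ⟨c₂, hc₂⟩ := hfresh β t b (p w) α α
    obtain ⟨s, hs⟩ := hfresh α a b β t c₂
    have huv₂ : ¬ G.Adj u v₂ := fun hadj => huw (hN₂ u hu hadj.symm)
    obtain ⟨c₁, hc₁⟩ := hfresh α s a t (p u) c₂
    have h' := h.extend v₂ c₂ {β, t} (fun _ => β) (fun _ => b)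
      (Finset.card_pair ht.2.1.symm) (by grind) (by grind) (by grind) (by grind)
    clear ih hG hlt hfresh
    refine ⟨_, _, _, h'.extend v₁ c₁ {α, s}
      (fun x => if x = v₂ then s else α) (fun x => if x = v₂ then t else a)
      (Finset.card_pair hs.1.symm) ?_ ?_ ?_ ?_⟩ <;> grind

end SimpleGraph

/-- If `G` is a finite outerplanar graph with `Δ(G) ≥ 4`, then `χ_{vi,2}(G) ≤ Δ(G) + 3`. -/
theorem chiViS_two_le_of_outerplanar [Fintype V] (G : SimpleGraph V) (hG : G.Outerplanar)
    (hΔ : 4 ≤ G.maxDeg) :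
    G.chiViS 2 ≤ G.maxDeg + 3 := by
  classical
  obtain ⟨r, hr⟩ := hG
  have hdeg : ∀ v, (G.neighborSet v).ncard ≤ G.maxDeg := fun v =>
    Finset.le_sup (f := fun v => (G.neighborSet v).ncard) (Finset.mem_univ v)
  obtain ⟨p, S, o, h⟩ := SimpleGraph.exists_isPaletteColoring_of_noncrossing
    (K := Fin (G.maxDeg + 3)) hr hΔ (by simp) hdeg Finset.univ
  let cI : V → Sym2 V → Fin (G.maxDeg + 3) := fun v e =>
    if hv : v ∈ e then o v (Sym2.Mem.other hv) else 0
  have hcI : ∀ v u, cI v s(v, u) = o v u := fun v u => by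
    have hv : v ∈ s(v, u) := Sym2.mem_mk_left v u
    have ho : Sym2.Mem.other hv = u := Sym2.congr_right.mp (Sym2.other_spec hv)
    simp only [cI, dif_pos hv, ho]
  have hcI' : ∀ v u, cI v s(u, v) = o v u := fun v u => by rw [Sym2.eq_swap, hcI]
  have hinc : ∀ v e, G.IsIncidence v e → ∃ u, G.Adj v u ∧ e = s(v, u) := by
    rintro v e ⟨he, u, rfl⟩
    exact ⟨u, he, rfl⟩
  obtain ⟨h1, h2, h3, h4, h5, h6, h7⟩ := h
  simp only [Finset.mem_univ, true_implies] at h1 h2 h3 h4 h5 h6 h7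
  refine Nat.sInf_le ⟨p, cI, ⟨h3, ?_, ?_⟩, fun u => ?_⟩
  · intro u w f hwf huf
    obtain ⟨x, hx, rfl⟩ := hinc w f hwf
    rw [hcI]
    rcases Sym2.mem_iff.mp huf with rfl | rfl
    · exact (h6 _ _ hx).symm
    · exact fun heq => h2 u (heq ▸ h4 _ _ hx)
  · intro v e w f hve hwf hne hcond
    obtain ⟨x, hx, rfl⟩ := hinc v e hve
    obtain ⟨y, hy, rfl⟩ := hinc w f hwf
    rw [hcI, hcI]
    have hto : ∀ a b c, G.Adj a b → G.Adj b c → o a b ≠ o b c := fun a b c hab hbc heq =>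
      h5 b c hbc (heq ▸ h4 a b hab)
    rcases eq_or_ne v w with rfl | hvw
    · exact h7 v x y hx hy (by rintro rfl; exact hne rfl)
    rcases hcond with hc | hc | hc | hc
    · exact absurd hc hvw
    · rcases Sym2.eq_iff.mp hc with ⟨h, -⟩ | ⟨rfl, rfl⟩
      · exact absurd h hvw
      · exact hto _ _ _ hx hy
    · obtain rfl : w = x := Sym2.congr_right.mp hc
      exact hto _ _ _ hx hy
    · obtain rfl : v = y := Sym2.congr_right.mp (Sym2.eq_swap.trans hc)
      exact (hto _ _ _ hy hx).symm
  · rw [← h1 u, ← Set.ncard_coe_finset]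
    refine Set.ncard_le_ncard ?_ (Set.toFinite _)
    rintro _ ⟨v, hv, rfl⟩
    rw [hcI']
    exact h4 v u hv.symm
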